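/- arXiv:1803.08970 — 2 statements merged into one kernel-verified Lean document; each statement's English description precedes it below -/
import Mathlib

section
/- Consider the scalar plant ẋ = x³ + u, its Euler approximate model F^a(x,u,T) := x + T(x³ + u), and the control law U(x,T) := −x − 3x³. Let F^e(x,u,T) denote the value at time T of the solution of ẏ = y³ + u with y(0) = x and u held constant (which exists for all (x,u) in any given compact set and all sufficiently small T ≥ 0). Then the pair (U, F^a) is MSEC with (U, F^e). (MSEC claim in Section IV, Example 1.) -/
open scoped BigOperators

noncomputable section

/-- Closed-loop map `F̄(x,e,T) = F(x, U(x+e,T), T)` (scalar case). -/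
def Fbar (F : ℝ → ℝ → ℝ → ℝ) (U : ℝ → ℝ → ℝ) : ℝ → ℝ → ℝ → ℝ :=
  fun x e T => F x (U (x + e) T) T

/-- `k`-fold iterate `α^k(0, {T_i})`. -/
def alphaIter (a : ℝ → ℝ → ℝ) (Ts : ℕ → ℝ) : ℕ → ℝ
  | 0 => 0
  | k + 1 => a (alphaIter a Ts k) (Ts k)

/-- Multi-step error consistency of `(U, Fa)` with `(U, Fe)` (scalar case). -/
def MSEC (U : ℝ → ℝ → ℝ) (Fa Fe : ℝ → ℝ → ℝ → ℝ) : Prop :=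
  ∀ L > (0:ℝ), ∀ η > (0:ℝ), ∀ X Eset : Set ℝ, IsCompact X → IsCompact Eset →
    ∃ a : ℝ → ℝ → ℝ, (∀ d t, 0 ≤ d → 0 ≤ t → 0 ≤ a d t) ∧
      ∃ Tstar > (0:ℝ),
        (∀ δ : ℝ, ∀ xe ∈ X, ∀ xa ∈ X, |xe - xa| ≤ δ →
          ∀ e ∈ Eset, ∀ T ∈ Set.Ioo (0:ℝ) Tstar,
            |Fbar Fe U xe e T - Fbar Fa U xa e T| ≤ a δ T) ∧
        (∀ Ts : ℕ → ℝ, (∀ i, Ts i ∈ Set.Ioo (0:ℝ) Tstar) →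
          ∀ k : ℕ, (∑ i ∈ Finset.range k, Ts i) ≤ L → alphaIter a Ts k ≤ η)

theorem abs_cube_sub_cube_le {R x y : ℝ} (hx : |x| ≤ R) (hy : |y| ≤ R) :
    |x ^ 3 - y ^ 3| ≤ 3 * R ^ 2 * |x - y| := by
  have h : x ^ 3 - y ^ 3 = (x ^ 2 + x * y + y ^ 2) * (x - y) := by ring
  rw [h, abs_mul]
  refine mul_le_mul_of_nonneg_right ?_ (abs_nonneg _)
  obtain ⟨hx1, hx2⟩ := abs_le.mp hx
  obtain ⟨hy1, hy2⟩ := abs_le.mp hy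
  rw [abs_le]
  constructor <;> nlinarith [sq_nonneg (x + y), sq_nonneg x, sq_nonneg y, sq_nonneg (x - y)]

theorem abs_cube_add_le {R M x u : ℝ} (hx : |x| ≤ R) (hu : |u| ≤ M) :
    |x ^ 3 + u| ≤ R ^ 3 + M := by
  refine (abs_add_le _ _).trans (add_le_add ?_ hu)
  rw [abs_pow]
  exact pow_le_pow_left₀ (abs_nonneg _) hx 3

/-- A solution of `ẏ = y³ + u` grows at most linearly in time over a short horizon. -/
theorem abs_cubic_flow_sub_le {R M x u τ : ℝ} {φ : ℝ → ℝ} (hx : |x| ≤ R) (hu : |u| ≤ M)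
    (h0 : φ 0 = x) (hφ : ∀ t ∈ Set.Icc (0:ℝ) τ, HasDerivAt φ (φ t ^ 3 + u) t)
    (hτ : ((R + 1) ^ 3 + M + 1) * τ ≤ 1) :
    ∀ t ∈ Set.Icc (0:ℝ) τ, |φ t - x| ≤ ((R + 1) ^ 3 + M + 1) * t := by
  have hR : 0 ≤ R := (abs_nonneg x).trans hx
  have hM : 0 ≤ M := (abs_nonneg u).trans hu
  have hpos : 0 < (R + 1) ^ 3 + M + 1 := by positivity
  intro t ht
  refine image_norm_le_of_norm_deriv_right_lt_deriv_boundary' (a := 0) (b := τ)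
    (f := fun t => φ t - x) (f' := fun t => φ t ^ 3 + u)
    (B := fun t => ((R + 1) ^ 3 + M + 1) * t) (B' := fun _ => (R + 1) ^ 3 + M + 1)
    ?_ ?_ ?_ ?_ ?_ ?_ ht
  · intro s hs
    exact ((hφ s hs).sub_const x).continuousAt.continuousWithinAt
  · intro s hs
    exact ((hφ s ⟨hs.1, hs.2.le⟩).sub_const x).hasDerivWithinAt
  · simp [h0]
  · fun_prop
  · intro s _
    simpa using ((hasDerivAt_id s).const_mul ((R + 1) ^ 3 + M + 1)).hasDerivWithinAt
  · intro s hs hb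
    simp only [Real.norm_eq_abs] at hb ⊢
    have h1 : |φ s - x| ≤ 1 := by
      rw [hb]
      exact (mul_le_mul_of_nonneg_left hs.2.le hpos.le).trans hτ
    have h2 : |φ s| ≤ R + 1 := by
      have := abs_add_le (φ s - x) x
      rw [sub_add_cancel] at this
      linarith
    linarith [abs_cube_add_le h2 hu]

/-- The one-step error of the Euler method for `ẏ = y³ + u` is quadratic in the step. -/
theorem abs_cubic_flow_sub_euler_le {R M x u T : ℝ} {φ : ℝ → ℝ} (hx : |x| ≤ R) (hu : |u| ≤ M)
    (hT0 : 0 ≤ T) (h0 : φ 0 = x)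
    (hφ : ∀ t ∈ Set.Icc (0:ℝ) T, HasDerivAt φ (φ t ^ 3 + u) t)
    (hT : ((R + 1) ^ 3 + M + 1) * T ≤ 1) :
    |φ T - (x + T * (x ^ 3 + u))| ≤
      3 * (R + 1) ^ 2 * ((R + 1) ^ 3 + M + 1) * T ^ 2 := by
  have hR : 0 ≤ R := (abs_nonneg x).trans hx
  have hM : 0 ≤ M := (abs_nonneg u).trans hu
  have hpos : 0 < (R + 1) ^ 3 + M + 1 := by positivity
  have hflow := abs_cubic_flow_sub_le hx hu h0 hφ hT
  have key := norm_image_sub_le_of_norm_deriv_le_segment' (a := 0) (b := T)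
    (f := fun t => φ t - t * (x ^ 3 + u)) (f' := fun t => φ t ^ 3 + u - 1 * (x ^ 3 + u))
    (C := 3 * (R + 1) ^ 2 * (((R + 1) ^ 3 + M + 1) * T))
    (fun t ht => ((hφ t ht).sub ((hasDerivAt_id t).mul_const _)).hasDerivWithinAt)
    (fun t ht => by
      have h1 : |φ t - x| ≤ ((R + 1) ^ 3 + M + 1) * T :=
        (hflow t ⟨ht.1, ht.2.le⟩).trans (mul_le_mul_of_nonneg_left ht.2.le hpos.le)
      have h2 : |φ t| ≤ R + 1 := by
        have := abs_add_le (φ t - x) x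
        rw [sub_add_cancel] at this
        linarith
      have h3 : φ t ^ 3 + u - 1 * (x ^ 3 + u) = φ t ^ 3 - x ^ 3 := by ring
      rw [h3, Real.norm_eq_abs]
      refine (abs_cube_sub_cube_le h2 (by linarith : |x| ≤ R + 1)).trans ?_
      gcongr)
    T ⟨hT0, le_rfl⟩
  simp only [Real.norm_eq_abs, h0] at key
  calc |φ T - (x + T * (x ^ 3 + u))|
      = |φ T - T * (x ^ 3 + u) - (x - 0 * (x ^ 3 + u))| := by congr 1; ring
    _ ≤ _ := key
    _ = _ := by ring

/-- Discrete Grönwall bound for the iterates of `(d, t) ↦ (1 + K t) d + C t²`. -/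
theorem alphaIter_affine_le {K C τ : ℝ} (hK : 0 ≤ K) (hC : 0 ≤ C) {Ts : ℕ → ℝ}
    (hTs : ∀ i, Ts i ∈ Set.Ioo (0:ℝ) τ) (k : ℕ) :
    alphaIter (fun d t => (1 + K * t) * d + C * t ^ 2) Ts k ≤
      C * τ * (∑ i ∈ Finset.range k, Ts i) * Real.exp (K * ∑ i ∈ Finset.range k, Ts i) := by
  have hτ : 0 < τ := (hTs 0).1.trans (hTs 0).2
  induction k with
  | zero => simp [alphaIter]
  | succ k ih =>
    rw [Finset.sum_range_succ]
    have hS : 0 ≤ ∑ i ∈ Finset.range k, Ts i := Finset.sum_nonneg fun i _ => (hTs i).1.le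
    set S := ∑ i ∈ Finset.range k, Ts i
    obtain ⟨ht0, ht1⟩ := hTs k
    set t := Ts k with ht
    have h1 : 1 + K * t ≤ Real.exp (K * t) := by linarith [Real.add_one_le_exp (K * t)]
    have h2 : 1 ≤ Real.exp (K * (S + t)) := Real.one_le_exp (by positivity)
    have h3 : Real.exp (K * (S + t)) = Real.exp (K * t) * Real.exp (K * S) := by
      rw [← Real.exp_add]; ring_nf
    have h4 : t ^ 2 ≤ τ * t * Real.exp (K * (S + t)) := by
      calc t ^ 2 = t * t * 1 := by ring
        _ ≤ _ := by gcongr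
    calc (1 + K * t) * alphaIter (fun d t => (1 + K * t) * d + C * t ^ 2) Ts k + C * t ^ 2
        ≤ (1 + K * t) * (C * τ * S * Real.exp (K * S))
          + C * (τ * t * Real.exp (K * (S + t))) := by gcongr
      _ ≤ Real.exp (K * t) * (C * τ * S * Real.exp (K * S))
          + C * (τ * t * Real.exp (K * (S + t))) := by gcongr
      _ = C * τ * (S + t) * Real.exp (K * (S + t)) := by rw [h3]; ring

theorem abs_cubic_feedback_sub_le {R x y : ℝ} (hx : |x| ≤ R) (hy : |y| ≤ R) :
    |(-x - 3 * x ^ 3) - (-y - 3 * y ^ 3)| ≤ (1 + 9 * R ^ 2) * |x - y| := by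
  have h : (-x - 3 * x ^ 3) - (-y - 3 * y ^ 3) = -((x - y) + 3 * (x ^ 3 - y ^ 3)) := by ring
  have h3 : |3 * (x ^ 3 - y ^ 3)| = 3 * |x ^ 3 - y ^ 3| := by rw [abs_mul]; norm_num
  rw [h, abs_neg]
  linarith [abs_add_le (x - y) (3 * (x ^ 3 - y ^ 3)), abs_cube_sub_cube_le hx hy]

/-- The Euler closed loop is Lipschitz in the state with constant `1 + O(T)`. -/
theorem abs_euler_closedLoop_sub_le {R x y e T : ℝ} (hx : |x| ≤ R) (hy : |y| ≤ R)
    (he : |e| ≤ R) (hT : 0 ≤ T) :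
    |(x + T * (x ^ 3 + (-(x + e) - 3 * (x + e) ^ 3)))
      - (y + T * (y ^ 3 + (-(y + e) - 3 * (y + e) ^ 3)))| ≤
      (1 + (1 + 39 * R ^ 2) * T) * |x - y| := by
  have hxe : |x + e| ≤ 2 * R := (abs_add_le _ _).trans (by linarith)
  have hye : |y + e| ≤ 2 * R := (abs_add_le _ _).trans (by linarith)
  have h1 := abs_cubic_feedback_sub_le hxe hye
  rw [add_sub_add_right_eq_sub] at h1
  have h2 := abs_cube_sub_cube_le hx hy
  set A := (-(x + e) - 3 * (x + e) ^ 3) - (-(y + e) - 3 * (y + e) ^ 3) with hA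
  have h3 : (x + T * (x ^ 3 + (-(x + e) - 3 * (x + e) ^ 3)))
      - (y + T * (y ^ 3 + (-(y + e) - 3 * (y + e) ^ 3)))
      = (x - y) + T * ((x ^ 3 - y ^ 3) + A) := by rw [hA]; ring
  rw [h3]
  calc |(x - y) + T * ((x ^ 3 - y ^ 3) + A)|
      ≤ |x - y| + |T * ((x ^ 3 - y ^ 3) + A)| := abs_add_le _ _
    _ = |x - y| + T * |(x ^ 3 - y ^ 3) + A| := by rw [abs_mul, abs_of_nonneg hT]
    _ ≤ |x - y| + T * (3 * R ^ 2 * |x - y| + (1 + 9 * (2 * R) ^ 2) * |x - y|) := by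
        gcongr
        exact (abs_add_le _ _).trans (add_le_add h2 h1)
    _ = _ := by ring

/-- MSEC claim of Section IV, Example 1: the Euler model of `ẋ = x³ + u` with the control
law `U(x,T) = −x − 3x³` is multi-step error consistent with the exact model. -/
theorem example_MSEC (Fe : ℝ → ℝ → ℝ → ℝ)
    -- `Fe` is the exact discrete-time model: on compact sets and small sampling periods it
    -- matches a solution of `ẏ = y³ + u` with constant input `u`
    (hFe : ∀ K : Set (ℝ × ℝ), IsCompact K → ∃ T' > (0:ℝ), ∀ p ∈ K,
      ∃ φ : ℝ → ℝ, φ 0 = p.1 ∧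
        (∀ t ∈ Set.Icc (0:ℝ) T', HasDerivAt φ ((φ t) ^ 3 + p.2) t) ∧
        (∀ T ∈ Set.Icc (0:ℝ) T', Fe p.1 p.2 T = φ T)) :
    MSEC (fun x _ => -x - 3 * x ^ 3) (fun x u T => x + T * (x ^ 3 + u)) Fe := by
  intro L hL η hη X E hX hE
  obtain ⟨R, hR⟩ := (hX.union hE).isBounded.exists_norm_le
  simp only [Real.norm_eq_abs] at hR
  have hXR : ∀ x ∈ X, |x| ≤ max R 0 := fun x hx => (hR x (Or.inl hx)).trans (le_max_left _ _)
  have hER : ∀ e ∈ E, |e| ≤ max R 0 := fun e he => (hR e (Or.inr he)).trans (le_max_left _ _)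
  have hR0 : 0 ≤ max R 0 := le_max_right _ _
  generalize max R 0 = r at hXR hER hR0
  have hcpt : IsCompact ((fun q : ℝ × ℝ => (q.1, -(q.1 + q.2) - 3 * (q.1 + q.2) ^ 3)) ''
      (X ×ˢ E)) := (hX.prod hE).image (by fun_prop)
  obtain ⟨T', hT', hsol⟩ := hFe _ hcpt
  obtain ⟨M, hM⟩ := hcpt.isBounded.exists_norm_le
  have hu : ∀ x ∈ X, ∀ e ∈ E, |-(x + e) - 3 * (x + e) ^ 3| ≤ max M 0 := fun x hx e he =>
    ((norm_snd_le _).trans (hM _ ⟨(x, e), ⟨hx, he⟩, rfl⟩)).trans (le_max_left _ _)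
  have hM0 : 0 ≤ max M 0 := le_max_right _ _
  generalize max M 0 = m at hu hM0
  set D := (r + 1) ^ 3 + m + 1 with hD
  have hDpos : 0 < D := by positivity
  set C := 3 * (r + 1) ^ 2 * D with hC
  have hCpos : 0 < C := by positivity
  set K := 1 + 39 * r ^ 2 with hK
  have hKpos : 0 < K := by positivity
  set B := C * L * Real.exp (K * L) with hB
  have hBpos : 0 < B := by positivity
  refine ⟨fun d t => (1 + K * t) * d + C * t ^ 2, fun d t hd ht => by positivity,
    min T' (min (1 / D) (η / B)), by positivity, ?_, ?_⟩
  · intro δ x hx y hy hxy e he T hT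
    obtain ⟨hT0, hT1⟩ := hT
    obtain ⟨hTT', hT1⟩ := lt_min_iff.mp hT1
    obtain ⟨hTD, -⟩ := lt_min_iff.mp hT1
    obtain ⟨φ, h0, hφ, hFφ⟩ := hsol _ ⟨(x, e), ⟨hx, he⟩, rfl⟩
    simp only at h0 hφ hFφ
    have hDT : D * T ≤ 1 := by
      rw [lt_div_iff₀ hDpos] at hTD
      linarith
    have h1 := abs_cubic_flow_sub_euler_le (hXR x hx) (hu x hx e he) hT0.le h0
      (fun t ht => hφ t ⟨ht.1, ht.2.trans hTT'.le⟩) hDT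
    have h2 := abs_euler_closedLoop_sub_le (hXR x hx) (hXR y hy) (hER e he) hT0.le
    have h3 : (1 + K * T) * |x - y| ≤ (1 + K * T) * δ := by gcongr
    simp only [Fbar]
    rw [hFφ T ⟨hT0.le, hTT'.le⟩]
    refine (abs_sub_le _ (x + T * (x ^ 3 + (-(x + e) - 3 * (x + e) ^ 3))) _).trans ?_
    linarith
  · intro Ts hTs k hk
    have hS : 0 ≤ ∑ i ∈ Finset.range k, Ts i := Finset.sum_nonneg fun i _ => (hTs i).1.le
    have hτ : min T' (min (1 / D) (η / B)) ≤ η / B :=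
      (min_le_right _ _).trans (min_le_right _ _)
    calc _ ≤ _ := alphaIter_affine_le hKpos.le hCpos.le hTs k
      _ ≤ C * (η / B) * L * Real.exp (K * L) := by gcongr
      _ = η / B * B := by rw [hB]; ring
      _ = η := div_mul_cancel₀ _ hBpos.ne'
end
end

section
/- Define F̄^a₂(x,e,T) := x − T·(3ex² + (1 + 3e²)x + e³ + e). Then F̄^a₂(x,−1,T) = x + T(3x² − 4x + 2) ≥ (1+T)x for all x ≥ 1 and T > 0. Consequently, for any x₀ ≥ 1, any constant T > 0 and the constant error sequence e_k = −1, the solution of x_{k+1} = F̄^a₂(x_k, e_k, T) satisfies x_k ≥ (1+T)^k x₀ for all k ∈ ℕ₀, and hence x_k → ∞ as k → ∞. (Divergence estimate in Section IV-B.) -/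
noncomputable section

/-- Closed-loop Euler approximate model of `ẋ = x³ + u` under `u = −(x+e) − (x+e)³`. -/
def FbarA2 (x e T : ℝ) : ℝ :=
  x - T * (3 * e * x ^ 2 + (1 + 3 * e ^ 2) * x + e ^ 3 + e)

/-- Solution of the discrete-time system `x_{k+1} = F(x_k, e_k, T_k)`. -/
def sol (F : ℝ → ℝ → ℝ → ℝ) (ξ : ℝ) (e : ℕ → ℝ) (T : ℕ → ℝ) : ℕ → ℝ
  | 0 => ξ
  | k + 1 => F (sol F ξ e T k) (e k) (T k)

theorem FbarA2_neg_one (x T : ℝ) :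
    FbarA2 x (-1) T = x + T * (3 * x ^ 2 - 4 * x + 2) := by
  unfold FbarA2
  ring

theorem le_FbarA2_neg_one {x T : ℝ} (hx : 1 ≤ x) (hT : 0 ≤ T) :
    (1 + T) * x ≤ FbarA2 x (-1) T := by
  have h : 0 ≤ T * ((3 * x - 2) * (x - 1)) :=
    mul_nonneg hT (mul_nonneg (by linarith) (by linarith))
  rw [FbarA2_neg_one]
  linarith

theorem pow_mul_le_sol_FbarA2 {x0 T : ℝ} (hx0 : 1 ≤ x0) (hT : 0 ≤ T) (k : ℕ) :
    (1 + T) ^ k * x0 ≤ sol FbarA2 x0 (fun _ => -1) (fun _ => T) k := by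
  induction k with
  | zero => simp [sol]
  | succ k ih =>
    have hpow : 1 ≤ (1 + T) ^ k := one_le_pow₀ (by linarith)
    have hx : 1 ≤ sol FbarA2 x0 (fun _ => -1) (fun _ => T) k :=
      (one_le_mul_of_one_le_of_one_le hpow hx0).trans ih
    calc (1 + T) ^ (k + 1) * x0 = (1 + T) * ((1 + T) ^ k * x0) := by ring
      _ ≤ (1 + T) * sol FbarA2 x0 (fun _ => -1) (fun _ => T) k :=
        mul_le_mul_of_nonneg_left ih (by linarith)
      _ ≤ _ := le_FbarA2_neg_one hx hT

/-- Divergence estimate of Section IV-B. -/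
theorem FbarA2_diverges :
    (∀ x T : ℝ, 1 ≤ x → 0 < T →
      FbarA2 x (-1) T = x + T * (3 * x ^ 2 - 4 * x + 2) ∧
      (1 + T) * x ≤ FbarA2 x (-1) T) ∧
    ∀ x0 : ℝ, 1 ≤ x0 → ∀ T : ℝ, 0 < T →
      (∀ k : ℕ, (1 + T) ^ k * x0 ≤ sol FbarA2 x0 (fun _ => -1) (fun _ => T) k) ∧
      Filter.Tendsto (fun k : ℕ => sol FbarA2 x0 (fun _ => -1) (fun _ => T) k)
        Filter.atTop Filter.atTop := by
  refine ⟨fun x T hx hT => ⟨FbarA2_neg_one x T, le_FbarA2_neg_one hx hT.le⟩,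
    fun x0 hx0 T hT => ⟨pow_mul_le_sol_FbarA2 hx0 hT.le, ?_⟩⟩
  exact Filter.tendsto_atTop_mono (pow_mul_le_sol_FbarA2 hx0 hT.le)
    ((tendsto_pow_atTop_atTop_of_one_lt (by linarith)).atTop_mul_const (by linarith))
end
end
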